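/- Let 1 < s < θ < q ≤ p, let λ > 0, a, b ≥ 0, δ₀ ∈ (0,1), and let f : ℝ → ℝ be continuous with 0 ≤ f(t)·t ≤ a|t|^q + b|t|^p for all |t| ≤ δ₀. Define F(t) := ∫₀^t f(τ) dτ, g(t) := λ|t|^{s−2}t + f(t), and G(t) := (λ/s)|t|^s + F(t). Then there exists δ₁ ∈ (0, δ₀] such that λ|t|^θ ≤ g(t)·t ≤ θ G(t) for all t with |t| ≤ δ₁. -/

import Mathlib

/-- The primitive of a function whose sign agrees with that of its argument is nonnegative. -/
theorem intervalIntegral_nonneg_of_mul_self_nonneg {f : ℝ → ℝ} {t : ℝ}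
    (hf : ∀ x : ℝ, |x| ≤ |t| → 0 ≤ f x * x) : 0 ≤ ∫ x in (0:ℝ)..t, f x := by
  have h := intervalIntegral.mul_integral_comp_mul_left (a := 0) (b := 1) (f := f) t
  rw [mul_zero, mul_one] at h
  rw [← h, ← intervalIntegral.integral_const_mul, intervalIntegral.integral_of_le zero_le_one]
  refine MeasureTheory.setIntegral_nonneg measurableSet_Ioc fun u hu => ?_
  have hu' : |t * u| ≤ |t| := by
    rw [abs_mul, abs_of_pos hu.1]
    exact mul_le_of_le_one_right (abs_nonneg t) hu.2
  refine nonneg_of_mul_nonneg_left ?_ hu.1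
  linarith [hf _ hu']

theorem abs_rpow_sub_two_mul_self_mul_self {s : ℝ} (hs : s ≠ 0) (t : ℝ) :
    |t| ^ (s - 2) * t * t = |t| ^ s := by
  rcases eq_or_ne t 0 with rfl | ht
  · simp [Real.zero_rpow hs]
  · rw [mul_assoc, ← abs_mul_abs_self t, ← sq, ← Real.rpow_two,
      ← Real.rpow_add (abs_pos.2 ht), sub_add_cancel]

/-- Near `0` a higher power is dominated by any positive multiple of a lower power. -/
theorem rpow_le_mul_rpow_of_le {x c s q : ℝ} (hx : 0 ≤ x) (hc : 0 ≤ c) (hs : 0 < s)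
    (hsq : s < q) (hxc : x ≤ c ^ (q - s)⁻¹) : x ^ q ≤ c * x ^ s := by
  have h : x ^ (q - s) ≤ c :=
    (Real.le_rpow_inv_iff_of_pos hx hc (sub_pos.2 hsq)).1 hxc
  calc x ^ q = x ^ (q - s) * x ^ s := by
        rw [← Real.rpow_add_of_nonneg hx (sub_pos.2 hsq).le hs.le, sub_add_cancel]
    _ ≤ c * x ^ s := by gcongr

/-- Two-sided inequality from the proof of Theorem 4.3, needed to compute the
critical groups of the truncated energy functional at `0`. -/
theorem stmt_9 (s θ q p lam a b δ₀ : ℝ) (f : ℝ → ℝ)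
    (hs : 1 < s) (hsθ : s < θ) (hθq : θ < q) (hqp : q ≤ p)
    (hlam : 0 < lam) (ha : 0 ≤ a) (hb : 0 ≤ b)
    (hδ₀ : 0 < δ₀) (hδ₀' : δ₀ < 1)
    (hf : Continuous f)
    (hsign : ∀ t : ℝ, |t| ≤ δ₀ → 0 ≤ f t * t ∧ f t * t ≤ a * |t| ^ q + b * |t| ^ p) :
    ∃ δ₁ : ℝ, 0 < δ₁ ∧ δ₁ ≤ δ₀ ∧ ∀ t : ℝ, |t| ≤ δ₁ →
      lam * |t| ^ θ ≤ (lam * |t| ^ (s - 2) * t + f t) * t ∧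
        (lam * |t| ^ (s - 2) * t + f t) * t ≤
          θ * (lam / s * |t| ^ s + ∫ τ in (0:ℝ)..t, f τ) := by
  have hs0 : 0 < s := by linarith
  set κ := lam * (θ / s - 1) with hκ
  have hκ0 : 0 < κ := mul_pos hlam (sub_pos.2 ((one_lt_div hs0).2 hsθ))
  set c := κ / (a + b + 1) with hc
  have hc0 : 0 < c := by positivity
  refine ⟨min δ₀ (c ^ (q - s)⁻¹), lt_min hδ₀ (Real.rpow_pos_of_pos hc0 _), min_le_left _ _,
    fun t ht => ?_⟩
  have htδ : |t| ≤ δ₀ := ht.trans (min_le_left _ _)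
  have ht1 : |t| ≤ 1 := htδ.trans hδ₀'.le
  obtain ⟨hft, hft'⟩ := hsign t htδ
  have hF : 0 ≤ ∫ τ in (0:ℝ)..t, f τ :=
    intervalIntegral_nonneg_of_mul_self_nonneg fun x hx => (hsign x (hx.trans htδ)).1
  have hg : (lam * |t| ^ (s - 2) * t + f t) * t = lam * |t| ^ s + f t * t := by
    rw [← abs_rpow_sub_two_mul_self_mul_self hs0.ne' t]
    ring
  have hts : 0 ≤ |t| ^ s := by positivity
  rw [hg]
  constructor
  · have h : |t| ^ θ ≤ |t| ^ s :=
      Real.rpow_le_rpow_of_exponent_ge' (abs_nonneg t) ht1 hs0.le hsθ.le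
    linarith [mul_le_mul_of_nonneg_left h hlam.le]
  · have hpq : |t| ^ p ≤ |t| ^ q :=
      Real.rpow_le_rpow_of_exponent_ge' (abs_nonneg t) ht1 (by linarith) hqp
    have hqs : |t| ^ q ≤ c * |t| ^ s :=
      rpow_le_mul_rpow_of_le (abs_nonneg t) hc0.le hs0 (hsθ.trans hθq)
        (ht.trans (min_le_right _ _))
    have hfκ : f t * t ≤ κ * |t| ^ s := by
      calc f t * t ≤ a * |t| ^ q + b * |t| ^ p := hft'
        _ ≤ a * |t| ^ q + b * |t| ^ q := by gcongr
        _ = (a + b) * |t| ^ q := by ring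
        _ ≤ (a + b + 1) * (c * |t| ^ s) :=
          mul_le_mul (by linarith) hqs (by positivity) (by positivity)
        _ = κ * |t| ^ s := by rw [hc]; field_simp
    calc lam * |t| ^ s + f t * t ≤ lam * |t| ^ s + κ * |t| ^ s := by gcongr
      _ = θ * (lam / s * |t| ^ s) := by rw [hκ]; ring
      _ ≤ θ * (lam / s * |t| ^ s + ∫ τ in (0:ℝ)..t, f τ) := by
        refine mul_le_mul_of_nonneg_left ?_ (by linarith)
        linarith
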